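/- arXiv:0712.1501 — 5 statements merged into one kernel-verified Lean document; each statement's English description precedes it below -/
import Mathlib

section
/- Let X be a finite metric graph with edge lengths satisfying 0 < ℓ₀ ≤ ℓ_e ≤ 1, let G ⊆ G^max be a vertex space with orthogonal projection P, and let L : G → G be a self-adjoint linear operator. Let z ∈ ℂ with z ≠ (πk/ℓ_e)² for every edge e and every integer k ≥ 1, and let θ ∈ ℂ with θ² = z. Define Q(z) : G → G by (Q(z)F)(v) := P_v( {(θ/sin(θℓ_e))(cos(θℓ_e) F_e(v) − F_e(v_e))}_{e∈E_v} ) for z ≠ 0 and Q(0) := Δ_G. Then the map F ↦ β(z)F is a linear bijection from ker(Q(z) − L) ⊆ G onto the eigenspace of the metric graph Laplacian Δ_{(G,L)} for the eigenvalue z, i.e. onto the space of families f = (f_e) with each f_e : [0,ℓ_e] → ℂ twice continuously differentiable, −f_e'' = z f_e on each edge, f̲ ∈ G, and P(f'̲°) = L f̲. -/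
noncomputable section

open Complex Set MeasureTheory

variable {V E : Type*}

/-- Maximal vertex space: one copy of `ℂ` for each half-edge `(e, endpoint)`;
`(e, false)` corresponds to the initial vertex `∂₋e`, `(e, true)` to the terminal
vertex `∂₊e`. -/
abbrev Gmax (E : Type*) := E × Bool → ℂ

/-- The vertex of a half-edge, given the boundary map `bd` of the graph
(`bd false = ∂₋`, `bd true = ∂₊`). -/
def hvtx (bd : Bool → E → V) (h : E × Bool) : V := bd h.2 h.1

/-- The opposite half-edge on the same edge. -/
def hopp {E : Type*} (h : E × Bool) : E × Bool := (h.1, !h.2)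

/-- The standard Hermitian inner product on `Gmax E` (conjugate-linear in the
first argument). -/
def vinner [Fintype E] (F F' : Gmax E) : ℂ :=
  ∑ h : E × Bool, (starRingEnd ℂ) (F h) * F' h

/-- The squared norm on `Gmax E`. -/
def vnormSq [Fintype E] (F : Gmax E) : ℝ := ∑ h : E × Bool, ‖F h‖ ^ 2

/-- Restriction of `F` to the components sitting at the vertex `v`. -/
def restrAt [DecidableEq V] (bd : Bool → E → V) (v : V) (F : Gmax E) : Gmax E :=
  fun h => if bd h.2 h.1 = v then F h else 0

/-- Unoriented vertex evaluation of a family of edge functions. -/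
def utrace (ℓ : E → ℝ) (f : E → ℝ → ℂ) : Gmax E :=
  fun h => if h.2 then f h.1 (ℓ h.1) else f h.1 0

/-- Oriented vertex evaluation of a family of edge functions. -/
def otrace (ℓ : E → ℝ) (f : E → ℝ → ℂ) : Gmax E :=
  fun h => if h.2 then f h.1 (ℓ h.1) else -f h.1 0

/-- The generalised discrete Laplacian `Δ_G`, written with the (local) orthogonal
projection `P` onto the vertex space. -/
def discLap (ℓ : E → ℝ) (P : Gmax E →ₗ[ℂ] Gmax E) (F : Gmax E) : Gmax E :=
  P fun h => (ℓ h.1 : ℂ)⁻¹ * (F h - F (hopp h))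

/-- Krein's Q-function, for spectral parameter `z = θ ^ 2 ≠ 0`. -/
def QRaw (ℓ : E → ℝ) (P : Gmax E →ₗ[ℂ] Gmax E) (θ : ℂ) (F : Gmax E) : Gmax E :=
  P fun h => (θ / Complex.sin (θ * (ℓ h.1 : ℂ))) *
      (Complex.cos (θ * (ℓ h.1 : ℂ)) * F h - F (hopp h))

/-- Krein's Q-function, including the value `z = 0` where `Q(0) = Δ_G`. -/
def QFull (ℓ : E → ℝ) (P : Gmax E →ₗ[ℂ] Gmax E) (z θ : ℂ) (F : Gmax E) : Gmax E :=
  if z = 0 then discLap ℓ P F else QRaw ℓ P θ F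

/-- The solution operator (Krein Γ-field) `β(z)` for `z = θ ^ 2 ≠ 0`. -/
def betaFun (ℓ : E → ℝ) (θ : ℂ) (F : Gmax E) : E → ℝ → ℂ := fun e x =>
  F (e, false) * Complex.sin (θ * ((ℓ e : ℂ) - (x : ℂ))) / Complex.sin (θ * (ℓ e : ℂ))
    + F (e, true) * Complex.sin (θ * (x : ℂ)) / Complex.sin (θ * (ℓ e : ℂ))

/-- The solution operator `β(z)`, including the value `z = 0`. -/
def betaFull (ℓ : E → ℝ) (z θ : ℂ) (F : Gmax E) : E → ℝ → ℂ :=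
  if z = 0 then
    fun e x => F (e, false) * (1 - (x : ℂ) / (ℓ e : ℂ)) + F (e, true) * ((x : ℂ) / (ℓ e : ℂ))
  else betaFun ℓ θ F

/-- `sin₁ θ = sin θ / θ` with `sin₁ 0 = 1`. -/
def sin1 (θ : ℂ) : ℂ := if θ = 0 then 1 else Complex.sin θ / θ

/-- `f` belongs to the eigenspace of the metric-graph Laplacian `Δ_{(G,L)}` for the
eigenvalue `z`: each `f_e` is twice continuously differentiable on `[0, ℓ_e]`,
`-f_e'' = z f_e` on each edge, the unoriented vertex evaluation lies in `G`, and the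
vertex condition `P f'̲° = L f̲` holds. -/
def IsLapEigenfun (ℓ : E → ℝ) (G : Submodule ℂ (Gmax E)) (P : Gmax E →ₗ[ℂ] Gmax E)
    (L : G →ₗ[ℂ] G) (z : ℂ) (f : E → ℝ → ℂ) : Prop :=
  (∀ e, ContDiffOn ℝ 2 (f e) (Icc 0 (ℓ e))) ∧
  (∀ e, ∀ x ∈ Icc (0 : ℝ) (ℓ e),
      iteratedDerivWithin 2 (f e) (Icc 0 (ℓ e)) x = -(z * f e x)) ∧
  ∃ hf : utrace ℓ f ∈ G,
    P (otrace ℓ fun e x => derivWithin (f e) (Icc 0 (ℓ e)) x)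
      = ↑(L ⟨utrace ℓ f, hf⟩)

/-- The edgewise derivative of `betaFull ℓ z θ F`. -/
def betaDeriv (ℓ : E → ℝ) (z θ : ℂ) (F : Gmax E) : E → ℝ → ℂ := fun e x =>
  if z = 0 then (F (e, true) - F (e, false)) / (ℓ e : ℂ)
  else θ / Complex.sin (θ * (ℓ e : ℂ)) * (F (e, true) * Complex.cos (θ * (x : ℂ))
    - F (e, false) * Complex.cos (θ * ((ℓ e : ℂ) - (x : ℂ))))

lemma hasDerivAt_betaFull (ℓ : E → ℝ) (z θ : ℂ) (F : Gmax E) (e : E) (x : ℝ) :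
    HasDerivAt (betaFull ℓ z θ F e) (betaDeriv ℓ z θ F e x) x := by
  have hx : HasDerivAt (fun y : ℝ => (y : ℂ)) 1 x := Complex.ofRealCLM.hasDerivAt
  by_cases hz : z = 0
  · simp only [betaFull, betaDeriv, hz, if_true]
    have h := ((hx.div_const (ℓ e : ℂ)).const_sub 1 |>.const_mul (F (e, false))).add
      ((hx.div_const (ℓ e : ℂ)).const_mul (F (e, true)))
    exact h.congr_deriv (by ring)
  · simp only [betaFull, betaDeriv, hz, if_false]
    have h₁ := (Complex.hasDerivAt_sin _).comp x ((hx.const_sub (ℓ e : ℂ)).const_mul θ)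
    have h₂ := (Complex.hasDerivAt_sin _).comp x (hx.const_mul θ)
    have h := ((h₁.const_mul (F (e, false))).div_const (Complex.sin (θ * (ℓ e : ℂ)))).add
      ((h₂.const_mul (F (e, true))).div_const (Complex.sin (θ * (ℓ e : ℂ))))
    exact h.congr_deriv (by ring)

lemma hasDerivAt_betaDeriv (ℓ : E → ℝ) {z θ : ℂ} (hθ : θ ^ 2 = z) (F : Gmax E) (e : E)
    (x : ℝ) : HasDerivAt (betaDeriv ℓ z θ F e) (-(z * betaFull ℓ z θ F e x)) x := by
  have hx : HasDerivAt (fun y : ℝ => (y : ℂ)) 1 x := Complex.ofRealCLM.hasDerivAt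
  by_cases hz : z = 0
  · unfold betaDeriv
    simp only [hz, if_true, zero_mul, neg_zero]
    exact hasDerivAt_const x _
  · unfold betaDeriv
    simp only [betaFull, betaFun, hz, if_false]
    have h₁ := (Complex.hasDerivAt_cos _).comp x ((hx.const_sub (ℓ e : ℂ)).const_mul θ)
    have h₂ := (Complex.hasDerivAt_cos _).comp x (hx.const_mul θ)
    have h := ((h₂.const_mul (F (e, true))).sub
      (h₁.const_mul (F (e, false)))).const_mul (θ / Complex.sin (θ * (ℓ e : ℂ)))
    refine h.congr_deriv ?_
    rw [← hθ]
    ring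

lemma contDiff_betaFull (ℓ : E → ℝ) (z θ : ℂ) (F : Gmax E) (e : E) :
    ContDiff ℝ 2 (betaFull ℓ z θ F e) := by
  have hx : ContDiff ℝ 2 (fun y : ℝ => (y : ℂ)) := Complex.ofRealCLM.contDiff
  by_cases hz : z = 0
  · simp only [betaFull, hz, if_true]
    fun_prop
  · simp only [betaFull, hz, if_false]
    have hsin : ContDiff ℝ 2 Complex.sin := Complex.contDiff_sin.restrict_scalars ℝ
    have h₁ : ContDiff ℝ 2 (fun y : ℝ => Complex.sin (θ * ((ℓ e : ℂ) - (y : ℂ)))) :=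
      hsin.comp (contDiff_const.mul (contDiff_const.sub hx))
    have h₂ : ContDiff ℝ 2 (fun y : ℝ => Complex.sin (θ * (y : ℂ))) :=
      hsin.comp (contDiff_const.mul hx)
    unfold betaFun
    fun_prop

lemma utrace_betaFull {ℓ : E → ℝ} {z θ : ℂ} (hℓ : ∀ e, ℓ e ≠ 0)
    (hs : z ≠ 0 → ∀ e, Complex.sin (θ * (ℓ e : ℂ)) ≠ 0) (F : Gmax E) :
    utrace ℓ (betaFull ℓ z θ F) = F := by
  ext ⟨e, b⟩
  have h := Complex.ofReal_ne_zero.mpr (hℓ e)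
  by_cases hz : z = 0
  · cases b <;> simp [utrace, betaFull, hz, h]
  · cases b <;> simp [utrace, betaFull, betaFun, hz, hs hz e]

lemma QFull_eq (ℓ : E → ℝ) (P : Gmax E →ₗ[ℂ] Gmax E) (z θ : ℂ) (F : Gmax E) :
    QFull ℓ P z θ F = P (otrace ℓ (betaDeriv ℓ z θ F)) := by
  by_cases hz : z = 0
  · simp only [QFull, discLap, hz, if_true]
    congr 1
    ext ⟨e, b⟩
    cases b <;> simp [otrace, betaDeriv, hopp] <;> ring
  · simp only [QFull, QRaw, hz, if_false]
    congr 1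
    ext ⟨e, b⟩
    cases b <;> simp only [otrace, betaDeriv, hopp, hz, if_false, if_true, Bool.not_false,
      Bool.not_true, Bool.false_eq_true, Complex.ofReal_zero, mul_zero, sub_zero, sub_self,
      Complex.cos_zero] <;> ring

lemma sin_mul_ne_zero {z θ : ℂ} (hθ : θ ^ 2 = z) {a : ℝ} (ha : a ≠ 0)
    (hz : ∀ k : ℕ, 1 ≤ k → z ≠ ((Real.pi * k / a : ℝ) : ℂ) ^ 2) (hz0 : z ≠ 0) :
    Complex.sin (θ * (a : ℂ)) ≠ 0 := by
  intro h
  obtain ⟨k, hk⟩ := Complex.sin_eq_zero_iff.mp h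
  have ha' : (a : ℂ) ≠ 0 := Complex.ofReal_ne_zero.mpr ha
  have hθk : θ = k * Real.pi / a := by rw [← hk]; field_simp
  have hk0 : k ≠ 0 := by
    rintro rfl
    apply hz0
    rw [← hθ, hθk]
    simp
  refine hz k.natAbs (by omega) ?_
  have hsq : ((k.natAbs : ℕ) : ℂ) ^ 2 = (k : ℂ) ^ 2 := by
    rw [← Int.cast_natCast, ← Int.cast_pow, Int.natAbs_sq, Int.cast_pow]
  rw [← hθ, hθk]
  push_cast
  rw [div_pow, div_pow, mul_pow, mul_pow, hsq]
  ring

/-- The Wronskian of two solutions of `-u'' = z u` on an interval is constant. -/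
lemma wronskian_eq {z : ℂ} {a : ℝ} {u u' w w' : ℝ → ℂ}
    (hu : ∀ x ∈ Icc 0 a, HasDerivWithinAt u (u' x) (Icc 0 a) x)
    (hu' : ∀ x ∈ Icc 0 a, HasDerivWithinAt u' (-(z * u x)) (Icc 0 a) x)
    (hw : ∀ x ∈ Icc 0 a, HasDerivWithinAt w (w' x) (Icc 0 a) x)
    (hw' : ∀ x ∈ Icc 0 a, HasDerivWithinAt w' (-(z * w x)) (Icc 0 a) x)
    {x y : ℝ} (hx : x ∈ Icc 0 a) (hy : y ∈ Icc 0 a) :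
    u x * w' x - u' x * w x = u y * w' y - u' y * w y := by
  have hd : ∀ t ∈ Icc 0 a,
      HasDerivWithinAt (fun s => u s * w' s - u' s * w s) 0 (Icc 0 a) t := by
    intro t ht
    exact (((hu t ht).mul (hw' t ht)).sub ((hu' t ht).mul (hw t ht))).congr_deriv (by ring)
  have hc := (convex_Icc 0 a).norm_image_sub_le_of_norm_hasDerivWithin_le (C := 0) hd
    (by simp) hy hx
  rw [zero_mul, norm_le_zero_iff, sub_eq_zero] at hc
  exact hc

lemma hasDerivWithinAt_derivWithin_of_contDiffOn_two {s : Set ℝ} (hs : UniqueDiffOn ℝ s)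
    {f : ℝ → ℂ} (hf : ContDiffOn ℝ 2 f s) {x : ℝ} (hx : x ∈ s) :
    HasDerivWithinAt (derivWithin f s) (iteratedDerivWithin 2 f s x) s x := by
  have h := hf.differentiableOn_iteratedDerivWithin (m := 1) (by exact_mod_cast one_lt_two) hs
  rw [iteratedDerivWithin_one] at h
  rw [iteratedDerivWithin_succ, iteratedDerivWithin_one]
  exact (h x hx).hasDerivWithinAt

/-- A solution of `-f'' = z f` on an edge is determined by its boundary values. -/
lemma eqOn_betaFull {ℓ : E → ℝ} {z θ : ℂ} (hθ : θ ^ 2 = z) (hℓ : ∀ e, 0 < ℓ e)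
    (hs : z ≠ 0 → ∀ e, Complex.sin (θ * (ℓ e : ℂ)) ≠ 0) {f : E → ℝ → ℂ} (e : E)
    (hf : ContDiffOn ℝ 2 (f e) (Icc 0 (ℓ e)))
    (hode : ∀ x ∈ Icc (0 : ℝ) (ℓ e),
      iteratedDerivWithin 2 (f e) (Icc 0 (ℓ e)) x = -(z * f e x)) :
    EqOn (f e) (betaFull ℓ z θ (utrace ℓ f) e) (Icc 0 (ℓ e)) := by
  intro x hx
  have hU : UniqueDiffOn ℝ (Icc 0 (ℓ e)) := uniqueDiffOn_Icc (hℓ e)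
  have hut := utrace_betaFull (z := z) (θ := θ) (fun e => (hℓ e).ne') hs
  have hβ (F : Gmax E) : ∀ x ∈ Icc 0 (ℓ e), HasDerivWithinAt (betaFull ℓ z θ F e)
      (betaDeriv ℓ z θ F e x) (Icc 0 (ℓ e)) x :=
    fun x _ => (hasDerivAt_betaFull ℓ z θ F e x).hasDerivWithinAt
  have hβ' (F : Gmax E) : ∀ x ∈ Icc 0 (ℓ e), HasDerivWithinAt (betaDeriv ℓ z θ F e)
      (-(z * betaFull ℓ z θ F e x)) (Icc 0 (ℓ e)) x :=
    fun x _ => (hasDerivAt_betaDeriv ℓ hθ F e x).hasDerivWithinAt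
  set g : ℝ → ℂ := fun x => f e x - betaFull ℓ z θ (utrace ℓ f) e x with hg_def
  set g' : ℝ → ℂ := fun x => derivWithin (f e) (Icc 0 (ℓ e)) x
    - betaDeriv ℓ z θ (utrace ℓ f) e x
  have hg : ∀ x ∈ Icc 0 (ℓ e), HasDerivWithinAt g (g' x) (Icc 0 (ℓ e)) x := fun x hx =>
    ((hf.differentiableOn (by norm_num)) x hx).hasDerivWithinAt.sub (hβ _ x hx)
  have hg' : ∀ x ∈ Icc 0 (ℓ e), HasDerivWithinAt g' (-(z * g x)) (Icc 0 (ℓ e)) x := by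
    intro x hx
    refine ((hasDerivWithinAt_derivWithin_of_contDiffOn_two hU hf hx).sub
      (hβ' (utrace ℓ f) x hx)).congr_deriv ?_
    rw [hode x hx, hg_def]
    ring
  have h0 (F : Gmax E) : betaFull ℓ z θ F e 0 = F (e, false) := by
    simpa [utrace] using congrFun (hut F) (e, false)
  have h1 (F : Gmax E) : betaFull ℓ z θ F e (ℓ e) = F (e, true) := by
    simpa [utrace] using congrFun (hut F) (e, true)
  have hg0 : g 0 = 0 := by simp [hg_def, h0, utrace]
  have hg1 : g (ℓ e) = 0 := by simp [hg_def, h1, utrace]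
  have m0 : (0 : ℝ) ∈ Icc 0 (ℓ e) := left_mem_Icc.mpr (hℓ e).le
  have m1 : ℓ e ∈ Icc 0 (ℓ e) := right_mem_Icc.mpr (hℓ e).le
  set p : Gmax E := fun h => if h.2 then 1 else 0 with hp
  set m : Gmax E := fun h => if h.2 then 0 else 1 with hm
  have wp := wronskian_eq hg hg' (hβ p) (hβ' p) hx m0
  have wm := wronskian_eq hg hg' (hβ m) (hβ' m) hx m1
  have wmp := wronskian_eq (hβ m) (hβ' m) (hβ p) (hβ' p) hx m0
  rw [hg0, h0] at wp
  rw [hg1, h1] at wm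
  rw [h0, h0] at wmp
  simp only [hp, hm, Bool.false_eq_true, if_true, if_false, mul_zero, zero_mul, one_mul,
    sub_zero] at wp wm wmp
  rw [← hp] at wp wmp
  rw [← hm] at wm wmp
  have hne : betaDeriv ℓ z θ p e 0 ≠ 0 := by
    by_cases hz : z = 0
    · simp [betaDeriv, hz, hp, (hℓ e).ne']
    · have hθ0 : θ ≠ 0 := by
        rintro rfl
        exact hz (by simp [← hθ])
      simp [betaDeriv, hz, hp, hs hz e, hθ0]
  have key : g x * betaDeriv ℓ z θ p e 0 = 0 := by
    linear_combination betaFull ℓ z θ m e x * wp - betaFull ℓ z θ p e x * wm - g x * wmp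
  exact sub_eq_zero.mp ((mul_eq_zero.mp key).resolve_right hne)

lemma otrace_congr {ℓ : E → ℝ} (hℓ : ∀ e, 0 ≤ ℓ e) {f g : E → ℝ → ℂ}
    (h : ∀ e, EqOn (f e) (g e) (Icc 0 (ℓ e))) : otrace ℓ f = otrace ℓ g := by
  ext ⟨e, b⟩
  cases b
  · simp [otrace, h e (left_mem_Icc.mpr (hℓ e))]
  · simp [otrace, h e (right_mem_Icc.mpr (hℓ e))]

lemma utrace_congr {ℓ : E → ℝ} (hℓ : ∀ e, 0 ≤ ℓ e) {f g : E → ℝ → ℂ}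
    (h : ∀ e, EqOn (f e) (g e) (Icc 0 (ℓ e))) : utrace ℓ f = utrace ℓ g := by
  ext ⟨e, b⟩
  cases b
  · simp [utrace, h e (left_mem_Icc.mpr (hℓ e))]
  · simp [utrace, h e (right_mem_Icc.mpr (hℓ e))]

/-- For a finite metric graph with edge lengths `ℓ₀ ≤ ℓ_e ≤ 1`, a
vertex space `G` with orthogonal projection `P`, a self-adjoint `L : G → G`, and
`z = θ²` avoiding the Dirichlet spectrum, the solution operator `β(z)` is a linear
bijection from `ker (Q(z) - L)` onto the eigenspace of `Δ_{(G,L)}` for the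
eigenvalue `z`. -/
theorem statement0 [Fintype V] [Fintype E] [DecidableEq V]
    (bd : Bool → E → V) (hdeg : ∀ v : V, ∃ h : E × Bool, bd h.2 h.1 = v)
    (ℓ : E → ℝ) (ℓ₀ : ℝ) (hℓ₀ : 0 < ℓ₀) (hℓ : ∀ e, ℓ₀ ≤ ℓ e ∧ ℓ e ≤ 1)
    (G : Submodule ℂ (Gmax E)) (P : Gmax E →ₗ[ℂ] Gmax E)
    (hPmem : ∀ F, P F ∈ G) (hPfix : ∀ F ∈ G, P F = F)
    (hPsa : ∀ F F' : Gmax E, vinner (P F) F' = vinner F (P F'))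
    (hPloc : ∀ (F : Gmax E) (v : V), P (restrAt bd v F) = restrAt bd v (P F))
    (L : G →ₗ[ℂ] G)
    (hL : ∀ x y : G,
      vinner (↑(L x) : Gmax E) (↑y : Gmax E) = vinner (↑x : Gmax E) (↑(L y) : Gmax E))
    (z θ : ℂ) (hθ : θ ^ 2 = z)
    (hz : ∀ e, ∀ k : ℕ, 1 ≤ k → z ≠ ((Real.pi * k / ℓ e : ℝ) : ℂ) ^ 2) :
    -- β(z) maps `ker (Q(z) - L)` into the eigenspace of `Δ_{(G,L)}` for `z`
    (∀ F : G, QFull ℓ P z θ (↑F : Gmax E) = (↑(L F) : Gmax E) →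
        IsLapEigenfun ℓ G P L z (betaFull ℓ z θ (↑F : Gmax E))) ∧
    -- β(z) is linear
    (∀ (F F' : Gmax E) (c : ℂ) (e : E) (x : ℝ),
        betaFull ℓ z θ (F + c • F') e x
          = betaFull ℓ z θ F e x + c * betaFull ℓ z θ F' e x) ∧
    -- β(z) is a bijection from `ker (Q(z) - L)` onto the eigenspace (each
    -- eigenfunction comes, on every edge interval, from a unique kernel element)
    (∀ f : E → ℝ → ℂ, IsLapEigenfun ℓ G P L z f →
        ∃! F : G, QFull ℓ P z θ (↑F : Gmax E) = (↑(L F) : Gmax E) ∧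
          ∀ e, EqOn (f e) (betaFull ℓ z θ (↑F : Gmax E) e) (Icc 0 (ℓ e))) := by
  have hpos (e : E) : 0 < ℓ e := hℓ₀.trans_le (hℓ e).1
  have hU (e : E) : UniqueDiffOn ℝ (Icc 0 (ℓ e)) := uniqueDiffOn_Icc (hpos e)
  have hs : z ≠ 0 → ∀ e, Complex.sin (θ * (ℓ e : ℂ)) ≠ 0 := fun hz0 e =>
    sin_mul_ne_zero hθ (hpos e).ne' (hz e) hz0
  have hut := utrace_betaFull (z := z) (θ := θ) (fun e => (hpos e).ne') hs
  have hderiv (F : Gmax E) (e : E) :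
      EqOn (derivWithin (betaFull ℓ z θ F e) (Icc 0 (ℓ e))) (betaDeriv ℓ z θ F e)
        (Icc 0 (ℓ e)) := fun x hx =>
    (hasDerivAt_betaFull ℓ z θ F e x).hasDerivWithinAt.derivWithin (hU e x hx)
  refine ⟨fun F hF => ⟨fun e => (contDiff_betaFull ℓ z θ F e).contDiffOn, ?_, ?_⟩, ?_, ?_⟩
  · intro e x hx
    have h := hasDerivWithinAt_derivWithin_of_contDiffOn_two (hU e)
      (contDiff_betaFull ℓ z θ (F : Gmax E) e).contDiffOn hx
    have h' := (hasDerivAt_betaDeriv ℓ hθ (F : Gmax E) e x).hasDerivWithinAt.congr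
      (hderiv F e) (hderiv F e hx)
    exact (hU e x hx).eq_deriv _ h h'
  · have hF' : (⟨utrace ℓ (betaFull ℓ z θ F), (hut F).symm ▸ F.2⟩ : G) = F :=
      Subtype.ext (hut F)
    refine ⟨(hut F).symm ▸ F.2, ?_⟩
    rw [hF', ← hF, QFull_eq, otrace_congr (fun e => (hpos e).le) (hderiv F)]
  · intro F F' c e x
    by_cases hz0 : z = 0
    · simp only [betaFull, hz0, if_true, Pi.add_apply, Pi.smul_apply, smul_eq_mul]
      ring
    · simp only [betaFull, betaFun, hz0, if_false, Pi.add_apply, Pi.smul_apply, smul_eq_mul]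
      ring
  · rintro f ⟨hf, hode, hG, hL'⟩
    have heq (e : E) := eqOn_betaFull hθ hpos hs e (hf e) (hode e)
    refine ⟨⟨utrace ℓ f, hG⟩, ⟨?_, heq⟩, ?_⟩
    · rw [← hL', QFull_eq]
      congr 1
      refine otrace_congr (fun e => (hpos e).le) fun e x hx => ?_
      rw [← hderiv _ e hx]
      exact (derivWithin_congr (heq e) (heq e hx)).symm
    · rintro F ⟨-, hF⟩
      refine Subtype.ext ?_
      rw [← hut F]
      exact (utrace_congr (fun e => (hpos e).le) hF).symm
end
end

section
/- Let X be a finite equilateral metric graph (all edge lengths ℓ_e = 1), G ⊆ G^max a vertex space with orthogonal projection P, and L : G → G a self-adjoint linear operator. Let λ ∈ ℂ with λ ≠ (πk)² for every integer k ≥ 1, and let θ ∈ ℂ with θ² = λ. Then λ is an eigenvalue of the metric graph Laplacian Δ_{(G,L)} (i.e. there is a nonzero family f = (f_e) with each f_e : [0,1] → ℂ twice continuously differentiable, −f_e'' = λ f_e on each edge, f̲ ∈ G, and P(f'̲°) = L f̲) if and only if 0 is an eigenvalue of the operator Δ_G − sin₁(θ)·L − (1 − cos θ)·Id on G. Moreover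 the corresponding eigenspaces have equal (finite) dimension. -/
noncomputable section

open Complex Set MeasureTheory

variable {V E : Type*}

/-- Kernel condition: `F ∈ ker (Δ_G - sin₁θ · L - (1 - cos θ) · Id)`. -/
def kerCond {E : Type*} (G : Submodule ℂ (Gmax E)) (P : Gmax E →ₗ[ℂ] Gmax E)
    (L : G →ₗ[ℂ] G) (θ : ℂ) (F : G) : Prop :=
  discLap (fun _ => 1) P (↑F : Gmax E) - sin1 θ • (↑(L F) : Gmax E)
      - (1 - Complex.cos θ) • (↑F : Gmax E) = 0

/-- The solution of `-S'' = θ² S` with `S 0 = 0` and `S' 0 = 1`. -/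
def sineSol (θ : ℂ) (x : ℝ) : ℂ := if θ = 0 then x else Complex.sin (θ * x) / θ

/-- The solution of `-C'' = θ² C` with `C 0 = 1` and `C' 0 = 0`. -/
def cosineSol (θ : ℂ) (x : ℝ) : ℂ := Complex.cos (θ * x)

@[simp] lemma sineSol_zero (θ : ℂ) : sineSol θ 0 = 0 := by simp [sineSol]

@[simp] lemma cosineSol_zero (θ : ℂ) : cosineSol θ 0 = 1 := by simp [cosineSol]

@[simp] lemma sineSol_one (θ : ℂ) : sineSol θ 1 = sin1 θ := by simp [sineSol, sin1]

@[simp] lemma cosineSol_one (θ : ℂ) : cosineSol θ 1 = Complex.cos θ := by simp [cosineSol]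

lemma cosineSol_sq_add_sineSol_sq (θ : ℂ) (x : ℝ) :
    cosineSol θ x ^ 2 + θ ^ 2 * sineSol θ x ^ 2 = 1 := by
  by_cases h : θ = 0
  · simp [cosineSol, sineSol, h]
  · have := Complex.sin_sq_add_cos_sq (θ * x)
    simp only [cosineSol, sineSol, h, if_false]
    field_simp
    linear_combination this

lemma hasDerivAt_sineSol (θ : ℂ) (x : ℝ) : HasDerivAt (sineSol θ) (cosineSol θ x) x := by
  by_cases h : θ = 0
  · subst h
    have h1 : sineSol 0 = fun x : ℝ => (x : ℂ) := by ext; simp [sineSol]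
    have h2 : cosineSol 0 x = 1 := by simp [cosineSol]
    rw [h1, h2]
    exact Complex.ofRealCLM.hasDerivAt
  · have h1 : sineSol θ = fun x : ℝ => Complex.sin (θ * x) / θ := by ext; simp [sineSol, h]
    have h2 : HasDerivAt (fun y : ℝ => θ * (y : ℂ)) (θ * 1) x :=
      Complex.ofRealCLM.hasDerivAt.const_mul θ
    rw [h1]
    refine (((Complex.hasDerivAt_sin (θ * x)).comp x h2).div_const θ).congr_deriv ?_
    rw [cosineSol]
    field_simp

lemma hasDerivAt_cosineSol (θ : ℂ) (x : ℝ) :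
    HasDerivAt (cosineSol θ) (-(θ ^ 2 * sineSol θ x)) x := by
  have h2 : HasDerivAt (fun y : ℝ => θ * (y : ℂ)) (θ * 1) x :=
    Complex.ofRealCLM.hasDerivAt.const_mul θ
  refine ((Complex.hasDerivAt_cos (θ * x)).comp x h2).congr_deriv ?_
  by_cases h : θ = 0
  · simp [h]
  · simp only [sineSol, h, if_false]
    field_simp

lemma contDiff_cosineSol (θ : ℂ) {n : WithTop ℕ∞} : ContDiff ℝ n (cosineSol θ) :=
  (Complex.contDiff_cos.restrict_scalars ℝ).comp
    (contDiff_const.mul Complex.ofRealCLM.contDiff)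

lemma contDiff_sineSol (θ : ℂ) {n : WithTop ℕ∞} : ContDiff ℝ n (sineSol θ) := by
  by_cases h : θ = 0
  · have h1 : sineSol θ = fun x : ℝ => (x : ℂ) := by ext; simp [sineSol, h]
    rw [h1]
    exact Complex.ofRealCLM.contDiff
  · have h1 : sineSol θ = fun x : ℝ => Complex.sin (θ * x) / θ := by ext; simp [sineSol, h]
    rw [h1]
    exact ((Complex.contDiff_sin.restrict_scalars ℝ).comp
      (contDiff_const.mul Complex.ofRealCLM.contDiff)).div_const θ

/-- A solution of `-u'' = θ² u` on `[0, 1]` is determined by its initial data. -/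
lemma eq_of_iteratedDerivWithin_two {θ : ℂ} {u : ℝ → ℂ} (hu : ContDiffOn ℝ 2 u (Icc 0 1))
    (hode : ∀ x ∈ Icc (0 : ℝ) 1, iteratedDerivWithin 2 u (Icc 0 1) x = -(θ ^ 2 * u x))
    {x : ℝ} (hx : x ∈ Icc (0 : ℝ) 1) :
    u x = u 0 * cosineSol θ x + derivWithin u (Icc 0 1) 0 * sineSol θ x ∧
    derivWithin u (Icc 0 1) x =
      derivWithin u (Icc 0 1) 0 * cosineSol θ x - θ ^ 2 * u 0 * sineSol θ x := by
  set g := derivWithin u (Icc (0 : ℝ) 1) with hg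
  have hud : UniqueDiffOn ℝ (Icc (0 : ℝ) 1) := uniqueDiffOn_Icc one_pos
  have h1 : ∀ y ∈ Icc (0 : ℝ) 1, HasDerivWithinAt u (g y) (Icc 0 1) y := fun y hy =>
    ((hu.differentiableOn (by norm_num)) y hy).hasDerivWithinAt
  have h2 : ∀ y ∈ Icc (0 : ℝ) 1, HasDerivWithinAt g (-(θ ^ 2 * u y)) (Icc 0 1) y := by
    intro y hy
    have hd : DifferentiableOn ℝ g (Icc 0 1) :=
      (hu.derivWithin hud (m := 1) (by norm_num)).differentiableOn (by norm_num)
    have := (hd y hy).hasDerivWithinAt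
    rwa [← hode y hy, iteratedDerivWithin_succ, iteratedDerivWithin_one]
  have hconst : ∀ w : ℝ → ℂ, (∀ y ∈ Icc (0 : ℝ) 1, HasDerivWithinAt w 0 (Icc 0 1) y) →
      w x = w 0 := by
    intro w hw
    exact constant_of_derivWithin_zero (fun y hy => (hw y hy).differentiableWithinAt)
      (fun y hy => (hw y (Ico_subset_Icc_self hy)).derivWithin
        (hud y (Ico_subset_Icc_self hy))) x hx
  have hS := fun y => (hasDerivAt_sineSol θ y).hasDerivWithinAt (s := Icc 0 1)
  have hC := fun y => (hasDerivAt_cosineSol θ y).hasDerivWithinAt (s := Icc 0 1)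
  have hA : u x * cosineSol θ x - g x * sineSol θ x = u 0 := by
    have := hconst (fun y => u y * cosineSol θ y - g y * sineSol θ y) fun y hy => by
      refine (((h1 y hy).mul (hC y)).sub ((h2 y hy).mul (hS y))).congr_deriv ?_
      ring
    simpa using this
  have hB : θ ^ 2 * (u x * sineSol θ x) + g x * cosineSol θ x = g 0 := by
    have := hconst (fun y => θ ^ 2 * (u y * sineSol θ y) + g y * cosineSol θ y) fun y hy => by
      refine ((((h1 y hy).mul (hS y)).const_mul (θ ^ 2)).add
        ((h2 y hy).mul (hC y))).congr_deriv ?_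
      ring
    simpa using this
  have hp := cosineSol_sq_add_sineSol_sq θ x
  constructor
  · linear_combination cosineSol θ x * hA + sineSol θ x * hB - u x * hp
  · linear_combination cosineSol θ x * hB - θ ^ 2 * sineSol θ x * hA - g x * hp

lemma sin1_ne_zero {θ : ℂ} (h : ∀ k : ℕ, 1 ≤ k → θ ^ 2 ≠ ((Real.pi * k : ℝ) : ℂ) ^ 2) :
    sin1 θ ≠ 0 := by
  by_cases h0 : θ = 0
  · simp [sin1, h0]
  · simp only [sin1, h0, if_false]
    refine div_ne_zero (fun hs => ?_) h0
    obtain ⟨k, rfl⟩ := Complex.sin_eq_zero_iff.1 hs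
    have hk : k ≠ 0 := by rintro rfl; simp at h0
    refine h k.natAbs (Int.natAbs_pos.2 hk) ?_
    have : ((k.natAbs : ℂ)) ^ 2 = (k : ℂ) ^ 2 := by
      rw [Nat.cast_natAbs]
      exact_mod_cast sq_abs k
    push_cast
    rw [mul_pow, mul_pow, this, mul_comm]

/-- The edgewise solution of `-f'' = θ² f` with vertex values `F`. -/
def dirichletSol (θ : ℂ) (F : Gmax E) (e : E) (x : ℝ) : ℂ :=
  F (e, false) * cosineSol θ x +
    (F (e, true) - F (e, false) * Complex.cos θ) / sin1 θ * sineSol θ x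

lemma utrace_dirichletSol {θ : ℂ} (hs : sin1 θ ≠ 0) (F : Gmax E) :
    utrace (fun _ => 1) (dirichletSol θ F) = F := by
  ext ⟨e, b⟩
  cases b
  · simp [utrace, dirichletSol]
  · simp [utrace, dirichletSol, hs]

lemma derivWithin_dirichletSol (θ : ℂ) (F : Gmax E) (e : E) {x : ℝ} (hx : x ∈ Icc (0 : ℝ) 1) :
    derivWithin (dirichletSol θ F e) (Icc 0 1) x =
      F (e, false) * -(θ ^ 2 * sineSol θ x) +
        (F (e, true) - F (e, false) * Complex.cos θ) / sin1 θ * cosineSol θ x :=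
  (((hasDerivAt_cosineSol θ x).const_mul _).add
    ((hasDerivAt_sineSol θ x).const_mul _)).hasDerivWithinAt.derivWithin
      (uniqueDiffOn_Icc one_pos x hx)

lemma contDiff_dirichletSol (θ : ℂ) (F : Gmax E) (e : E) {n : WithTop ℕ∞} :
    ContDiff ℝ n (dirichletSol θ F e) :=
  (contDiff_const.mul (contDiff_cosineSol θ)).add (contDiff_const.mul (contDiff_sineSol θ))

lemma iteratedDerivWithin_two_dirichletSol (θ : ℂ) (F : Gmax E) (e : E) {x : ℝ}
    (hx : x ∈ Icc (0 : ℝ) 1) :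
    iteratedDerivWithin 2 (dirichletSol θ F e) (Icc 0 1) x =
      -(θ ^ 2 * dirichletSol θ F e x) := by
  rw [iteratedDerivWithin_succ, iteratedDerivWithin_one,
    derivWithin_congr (fun y hy => derivWithin_dirichletSol θ F e hy)
      (derivWithin_dirichletSol θ F e hx)]
  have := (((((hasDerivAt_sineSol θ x).const_mul (θ ^ 2)).neg).const_mul (F (e, false))).add
    ((hasDerivAt_cosineSol θ x).const_mul
      ((F (e, true) - F (e, false) * Complex.cos θ) / sin1 θ))).hasDerivWithinAt.derivWithin
      (uniqueDiffOn_Icc one_pos x hx)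
  refine this.trans ?_
  simp only [dirichletSol]
  ring

/-- The Dirichlet-to-Neumann map of `-f'' = θ² f` on the edges. -/
lemma otrace_derivWithin_dirichletSol {θ : ℂ} (hs : sin1 θ ≠ 0) (F : Gmax E) :
    otrace (fun _ => 1) (fun e x => derivWithin (dirichletSol θ F e) (Icc 0 1) x) =
      (sin1 θ)⁻¹ • fun h => Complex.cos θ * F h - F (hopp h) := by
  have hp := cosineSol_sq_add_sineSol_sq θ 1
  rw [cosineSol_one, sineSol_one] at hp
  ext ⟨e, b⟩
  cases b
  · simp only [otrace, derivWithin_dirichletSol θ F e (left_mem_Icc.2 zero_le_one)]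
    simp [hopp]
    ring
  · simp only [otrace, derivWithin_dirichletSol θ F e (right_mem_Icc.2 zero_le_one)]
    simp [hopp]
    field_simp
    linear_combination -F (e, false) * hp

lemma kerCond_iff {G : Submodule ℂ (Gmax E)} {P : Gmax E →ₗ[ℂ] Gmax E}
    (hPfix : ∀ F ∈ G, P F = F) (L : G →ₗ[ℂ] G) {θ : ℂ} (hs : sin1 θ ≠ 0) (F : G) :
    kerCond G P L θ F ↔
      P ((sin1 θ)⁻¹ • fun h => Complex.cos θ * (F : Gmax E) h - (F : Gmax E) (hopp h)) = L F := by
  have h1 : (fun h => Complex.cos θ * (F : Gmax E) h - (F : Gmax E) (hopp h)) =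
      (fun h => (((1 : ℝ) : ℂ))⁻¹ * ((F : Gmax E) h - (F : Gmax E) (hopp h)))
        - (1 - Complex.cos θ) • (F : Gmax E) := by
    ext h
    simp
    ring
  rw [h1, map_smul, map_sub, map_smul, hPfix F F.2, inv_smul_eq_iff₀ hs, kerCond, discLap,
    sub_right_comm, sub_eq_zero]

lemma isLapEigenfun_dirichletSol_iff {G : Submodule ℂ (Gmax E)} {P : Gmax E →ₗ[ℂ] Gmax E}
    (hPfix : ∀ F ∈ G, P F = F) (L : G →ₗ[ℂ] G) {θ : ℂ} (hs : sin1 θ ≠ 0) (F : G) :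
    IsLapEigenfun (fun _ => 1) G P L (θ ^ 2) (dirichletSol θ F) ↔ kerCond G P L θ F := by
  have hu := utrace_dirichletSol hs (F : Gmax E)
  have hmem : utrace (fun _ => 1) (dirichletSol θ (F : Gmax E)) ∈ G := hu.symm ▸ F.2
  have hF : (⟨_, hmem⟩ : G) = F := Subtype.ext hu
  rw [kerCond_iff hPfix L hs, ← otrace_derivWithin_dirichletSol hs]
  constructor
  · rintro ⟨-, -, hf, h⟩
    rw [hF] at h
    exact h
  · intro h
    refine ⟨fun e => (contDiff_dirichletSol θ _ e).contDiffOn,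
      fun e x hx => iteratedDerivWithin_two_dirichletSol θ _ e hx, hmem, ?_⟩
    rw [hF]
    exact h

lemma IsLapEigenfun.eqOn_dirichletSol {G : Submodule ℂ (Gmax E)} {P : Gmax E →ₗ[ℂ] Gmax E}
    {L : G →ₗ[ℂ] G} {θ : ℂ} (hs : sin1 θ ≠ 0) {f : E → ℝ → ℂ}
    (hf : IsLapEigenfun (fun _ => 1) G P L (θ ^ 2) f) (e : E) :
    EqOn (f e) (dirichletSol θ (utrace (fun _ => 1) f) e) (Icc 0 1) := by
  intro x hx
  have h1 := (eq_of_iteratedDerivWithin_two (hf.1 e) (hf.2.1 e) (right_mem_Icc.2 zero_le_one)).1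
  rw [(eq_of_iteratedDerivWithin_two (hf.1 e) (hf.2.1 e) hx).1]
  simp only [cosineSol_one, sineSol_one] at h1
  simp only [dirichletSol, utrace, if_true, Bool.false_eq_true, if_false, h1]
  field_simp
  ring

lemma IsLapEigenfun.congr {G : Submodule ℂ (Gmax E)} {P : Gmax E →ₗ[ℂ] Gmax E}
    {L : G →ₗ[ℂ] G} {z : ℂ} {f g : E → ℝ → ℂ} (hf : IsLapEigenfun (fun _ => 1) G P L z f)
    (h : ∀ e, EqOn (f e) (g e) (Icc 0 1)) : IsLapEigenfun (fun _ => 1) G P L z g := by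
  obtain ⟨h1, h2, h3, h4⟩ := hf
  have hu : utrace (fun _ => 1) f = utrace (fun _ => 1) g := by
    ext i
    simp only [utrace, h i.1 (left_mem_Icc.2 zero_le_one), h i.1 (right_mem_Icc.2 zero_le_one)]
  have ho : (otrace (fun _ => 1) fun e x => derivWithin (f e) (Icc 0 1) x) =
      otrace (fun _ => 1) fun e x => derivWithin (g e) (Icc 0 1) x := by
    ext i
    simp only [otrace, derivWithin_congr (h i.1) (h i.1 (left_mem_Icc.2 zero_le_one)),
      derivWithin_congr (h i.1) (h i.1 (right_mem_Icc.2 zero_le_one))]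
  refine ⟨fun e => (h1 e).congr fun x hx => (h e hx).symm, fun e x hx => ?_, hu ▸ h3, ?_⟩
  · rw [← h e hx, ← h2 e x hx]
    exact (iteratedDerivWithin_congr (h e) hx).symm
  · simp only [← hu]
    exact ho ▸ h4

/-- On a finite equilateral metric graph (`ℓ_e = 1`), `λ = θ²` off
the Dirichlet spectrum is an eigenvalue of `Δ_{(G,L)}` iff `0` is an eigenvalue of
`Δ_G - sin₁θ·L - (1 - cos θ)·Id` on `G`; moreover the two eigenspaces have the same
dimension (there is a linear bijection between them). -/
theorem statement1 [Fintype V] [Fintype E] [DecidableEq V]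
    (bd : Bool → E → V) (hdeg : ∀ v : V, ∃ h : E × Bool, bd h.2 h.1 = v)
    (G : Submodule ℂ (Gmax E)) (P : Gmax E →ₗ[ℂ] Gmax E)
    (hPmem : ∀ F, P F ∈ G) (hPfix : ∀ F ∈ G, P F = F)
    (hPsa : ∀ F F' : Gmax E, vinner (P F) F' = vinner F (P F'))
    (hPloc : ∀ (F : Gmax E) (v : V), P (restrAt bd v F) = restrAt bd v (P F))
    (L : G →ₗ[ℂ] G)
    (hL : ∀ x y : G,
      vinner (↑(L x) : Gmax E) (↑y : Gmax E) = vinner (↑x : Gmax E) (↑(L y) : Gmax E))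
    (lam θ : ℂ) (hθ : θ ^ 2 = lam)
    (hlam : ∀ k : ℕ, 1 ≤ k → lam ≠ ((Real.pi * k : ℝ) : ℂ) ^ 2) :
    -- the spectral relation for eigenvalues
    ((∃ f : E → ℝ → ℂ,
        IsLapEigenfun (fun _ => 1) G P L lam f ∧
          ∃ e, ∃ x ∈ Icc (0 : ℝ) 1, f e x ≠ 0) ↔
      ∃ F : G, F ≠ 0 ∧ kerCond G P L θ F) ∧
    -- the eigenspaces have equal (finite) dimension: a linear bijection
    (∃ Φ : Gmax E → E → ℝ → ℂ,
      (∀ (F F' : Gmax E) (c : ℂ) (e : E) (x : ℝ),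
          Φ (F + c • F') e x = Φ F e x + c * Φ F' e x) ∧
      (∀ F : G, kerCond G P L θ F → IsLapEigenfun (fun _ => 1) G P L lam (Φ ↑F)) ∧
      (∀ F F' : G, kerCond G P L θ F → kerCond G P L θ F' →
          (∀ e, EqOn (Φ (↑F : Gmax E) e) (Φ (↑F' : Gmax E) e) (Icc 0 1)) → F = F') ∧
      (∀ f : E → ℝ → ℂ, IsLapEigenfun (fun _ => 1) G P L lam f →
          ∃ F : G, kerCond G P L θ F ∧
            ∀ e, EqOn (f e) (Φ (↑F : Gmax E) e) (Icc 0 1))) := by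
  subst hθ
  have hs : sin1 θ ≠ 0 := sin1_ne_zero hlam
  have hker := isLapEigenfun_dirichletSol_iff hPfix L hs
  have hsol : ∀ f : E → ℝ → ℂ, IsLapEigenfun (fun _ => 1) G P L (θ ^ 2) f →
      ∃ F : G, kerCond G P L θ F ∧ ∀ e, EqOn (f e) (dirichletSol θ (F : Gmax E) e) (Icc 0 1) :=
    fun f hf => ⟨⟨_, hf.2.2.1⟩, (hker _).1 (hf.congr (hf.eqOn_dirichletSol hs)),
      hf.eqOn_dirichletSol hs⟩
  have hinj : ∀ F F' : Gmax E,
      (∀ e, EqOn (dirichletSol θ F e) (dirichletSol θ F' e) (Icc 0 1)) → F = F' := by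
    intro F F' h
    rw [← utrace_dirichletSol hs F, ← utrace_dirichletSol hs F']
    ext i
    simp only [utrace, h i.1 (left_mem_Icc.2 zero_le_one), h i.1 (right_mem_Icc.2 zero_le_one)]
  refine ⟨⟨?_, ?_⟩, dirichletSol θ, ?_, fun F => (hker F).2,
    fun F F' _ _ h => Subtype.ext (hinj _ _ h), hsol⟩
  · rintro ⟨f, hf, e, x, hx, hne⟩
    obtain ⟨F, hF, hfF⟩ := hsol f hf
    refine ⟨F, ?_, hF⟩
    rintro rfl
    exact hne (by simp [hfF e hx, dirichletSol])
  · rintro ⟨F, hF, hk⟩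
    refine ⟨dirichletSol θ F, (hker F).2 hk, ?_⟩
    by_contra! hzero
    refine hF (Subtype.ext (hinj _ _ fun e x hx => ?_))
    rw [hzero e x hx]
    simp [dirichletSol]
  · intro F F' c e x
    simp only [dirichletSol, Pi.add_apply, Pi.smul_apply, smul_eq_mul]
    ring
end
end

section
/- Let X be a finite equilateral metric graph (all ℓ_e = 1), G ⊆ G^max a vertex space with projection P, m ∈ ℝ, and M : G → G a self-adjoint linear operator. Let μ ∈ ℂ with μ² − m² ≠ (πk)² for every integer k ≥ 0 (in particular μ ≠ ±m), and let θ ∈ ℂ with θ² = μ² − m². Then μ is an eigenvalue of the metric graph Dirac operator D_{(G,M)} (i.e. there is a nonzero pair f = (f₀,f₁) of edgewise continuously differentiable families satisfying m f₀ − f₁' = μ f₀ and f₀' − m f₁ = μ f₁ on every edge, f̲₀ ∈ G, and P(f̲₁°) = M f̲₀) if and only if 0 is an eigenvalue of the operator Δ_G − sin₁(θ)·(μ+m)·M − (1 − cos θ)·Id on G. Moreover the corresponding eigenspaces have equal dimension. -/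
noncomputable section

open Complex Set MeasureTheory

variable {V E : Type*}

/-- `(f₀, f₁)` belongs to the eigenspace of the metric-graph Dirac operator
`D_{(G,M)}` for the eigenvalue `w` (equilateral case `ℓ_e = 1`). -/
def IsDiracEigenfun {E : Type*} (ℓ : E → ℝ) (G : Submodule ℂ (Gmax E))
    (P : Gmax E →ₗ[ℂ] Gmax E) (M : G →ₗ[ℂ] G) (m : ℝ) (w : ℂ)
    (f₀ f₁ : E → ℝ → ℂ) : Prop :=
  (∀ e, ContDiffOn ℝ 1 (f₀ e) (Icc 0 (ℓ e))) ∧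
  (∀ e, ContDiffOn ℝ 1 (f₁ e) (Icc 0 (ℓ e))) ∧
  (∀ e, ∀ x ∈ Icc (0 : ℝ) (ℓ e),
      (m : ℂ) * f₀ e x - derivWithin (f₁ e) (Icc 0 (ℓ e)) x = w * f₀ e x) ∧
  (∀ e, ∀ x ∈ Icc (0 : ℝ) (ℓ e),
      derivWithin (f₀ e) (Icc 0 (ℓ e)) x - (m : ℂ) * f₁ e x = w * f₁ e x) ∧
  ∃ hf : utrace ℓ f₀ ∈ G,
    P (otrace ℓ f₁) = ↑(M ⟨utrace ℓ f₀, hf⟩)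

/-- Kernel condition: `F ∈ ker (Δ_G - sin₁θ·(μ+m)·M - (1 - cos θ)·Id)`. -/
def kerCondD {E : Type*} (G : Submodule ℂ (Gmax E)) (P : Gmax E →ₗ[ℂ] Gmax E)
    (M : G →ₗ[ℂ] G) (m : ℝ) (μ θ : ℂ) (F : G) : Prop :=
  discLap (fun _ => 1) P (↑F : Gmax E) - (sin1 θ * (μ + (m : ℂ))) • (↑(M F) : Gmax E)
      - (1 - Complex.cos θ) • (↑F : Gmax E) = 0

/-- The first component of the Dirac solution with boundary values `F`. -/
def diracSol₀ (θ : ℂ) (F : Gmax E) : E → ℝ → ℂ := fun e x =>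
  (F (e, false) * Complex.sin (θ * (1 - x)) + F (e, true) * Complex.sin (θ * x)) / Complex.sin θ

/-- The second component of the Dirac solution whose first component has boundary values `F`;
here `s` stands for the sum `μ + m`. -/
def diracSol₁ (s θ : ℂ) (F : Gmax E) : E → ℝ → ℂ := fun e x =>
  θ / s * ((F (e, true) * Complex.cos (θ * x) - F (e, false) * Complex.cos (θ * (1 - x))) /
    Complex.sin θ)

lemma utrace_diracSol₀ {θ : ℂ} (hs : Complex.sin θ ≠ 0) (F : Gmax E) :
    utrace (fun _ => 1) (diracSol₀ θ F) = F := by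
  funext ⟨e, b⟩
  cases b <;> simp [utrace, diracSol₀, hs]

lemma otrace_diracSol₁ (s θ : ℂ) (F : Gmax E) :
    otrace (fun _ => 1) (diracSol₁ s θ F) =
      (θ / s / Complex.sin θ) • (Complex.cos θ • F - fun h => F (hopp h)) := by
  funext ⟨e, b⟩
  cases b <;> simp [otrace, diracSol₁, hopp] <;> ring

lemma hasDerivAt_cos_mul_ofReal (θ : ℂ) (x : ℝ) :
    HasDerivAt (fun x : ℝ => Complex.cos (θ * x)) (-Complex.sin (θ * x) * θ) x := by
  simpa using (((hasDerivAt_id (x : ℂ)).const_mul θ).ccos).comp_ofReal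

lemma hasDerivAt_sin_mul_ofReal (θ : ℂ) (x : ℝ) :
    HasDerivAt (fun x : ℝ => Complex.sin (θ * x)) (Complex.cos (θ * x) * θ) x := by
  simpa using (((hasDerivAt_id (x : ℂ)).const_mul θ).csin).comp_ofReal

lemma hasDerivAt_cos_mul_one_sub_ofReal (θ : ℂ) (x : ℝ) :
    HasDerivAt (fun x : ℝ => Complex.cos (θ * (1 - x))) (Complex.sin (θ * (1 - x)) * θ) x := by
  simpa using ((((hasDerivAt_id (x : ℂ)).const_sub 1).const_mul θ).ccos).comp_ofReal

lemma hasDerivAt_sin_mul_one_sub_ofReal (θ : ℂ) (x : ℝ) :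
    HasDerivAt (fun x : ℝ => Complex.sin (θ * (1 - x))) (-(Complex.cos (θ * (1 - x)) * θ)) x := by
  simpa using ((((hasDerivAt_id (x : ℂ)).const_sub 1).const_mul θ).csin).comp_ofReal

lemma hasDerivAt_diracSol₀ {s θ : ℂ} (hs : s ≠ 0) (F : Gmax E) (e : E) (x : ℝ) :
    HasDerivAt (diracSol₀ θ F e) (s * diracSol₁ s θ F e x) x := by
  refine HasDerivAt.congr_deriv (f := diracSol₀ θ F e)
    ((((hasDerivAt_sin_mul_one_sub_ofReal θ x).const_mul (F (e, false))).add
      ((hasDerivAt_sin_mul_ofReal θ x).const_mul (F (e, true)))).div_const (Complex.sin θ)) ?_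
  simp only [diracSol₁]
  field_simp
  ring

lemma hasDerivAt_diracSol₁ {s d θ : ℂ} (hs : s ≠ 0) (h : θ ^ 2 = s * d) (F : Gmax E) (e : E)
    (x : ℝ) : HasDerivAt (diracSol₁ s θ F e) (-d * diracSol₀ θ F e x) x := by
  refine HasDerivAt.congr_deriv (f := diracSol₁ s θ F e)
    (((((hasDerivAt_cos_mul_ofReal θ x).const_mul (F (e, true))).sub
      ((hasDerivAt_cos_mul_one_sub_ofReal θ x).const_mul (F (e, false)))).div_const
        (Complex.sin θ)).const_mul (θ / s)) ?_
  obtain rfl : d = θ ^ 2 / s := by rw [h]; field_simp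
  simp only [diracSol₀]
  ring

lemma contDiff_diracSol₀ (θ : ℂ) (F : Gmax E) (e : E) : ContDiff ℝ 1 (diracSol₀ θ F e) := by
  have h : ContDiff ℝ 1 (fun x : ℝ => (x : ℂ)) := Complex.ofRealCLM.contDiff
  have hsin : ContDiff ℝ 1 Complex.sin := Complex.contDiff_sin.restrict_scalars ℝ
  unfold diracSol₀
  refine ContDiff.div_const ?_ _
  fun_prop

lemma contDiff_diracSol₁ (s θ : ℂ) (F : Gmax E) (e : E) : ContDiff ℝ 1 (diracSol₁ s θ F e) := by
  have h : ContDiff ℝ 1 (fun x : ℝ => (x : ℂ)) := Complex.ofRealCLM.contDiff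
  have hcos : ContDiff ℝ 1 Complex.cos := Complex.contDiff_cos.restrict_scalars ℝ
  unfold diracSol₁
  refine contDiff_const.mul (ContDiff.div_const ?_ _)
  fun_prop

/-- A solution of the first-order system `f₀' = s f₁`, `f₁' = -d f₀` on `[0, 1]` with `s d = θ²`
is determined by its initial values. -/
lemma dirac_system_eqOn {s d θ : ℂ} (hθ : θ ≠ 0) (h : θ ^ 2 = s * d) {f₀ f₁ : ℝ → ℂ}
    (h₀ : ∀ x ∈ Icc (0 : ℝ) 1, HasDerivWithinAt f₀ (s * f₁ x) (Icc 0 1) x)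
    (h₁ : ∀ x ∈ Icc (0 : ℝ) 1, HasDerivWithinAt f₁ (-d * f₀ x) (Icc 0 1) x)
    {x : ℝ} (hx : x ∈ Icc (0 : ℝ) 1) :
    f₀ x = f₀ 0 * Complex.cos (θ * x) + s / θ * f₁ 0 * Complex.sin (θ * x) ∧
      s / θ * f₁ x = s / θ * f₁ 0 * Complex.cos (θ * x) - f₀ 0 * Complex.sin (θ * x) := by
  have conserved : ∀ g : ℝ → ℂ, (∀ y ∈ Icc (0 : ℝ) 1, HasDerivWithinAt g 0 (Icc 0 1) y) →
      g x = g 0 := fun g hg =>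
    constant_of_derivWithin_zero (fun y hy => (hg y hy).differentiableWithinAt)
      (fun y hy => (hg y (Ico_subset_Icc_self hy)).derivWithin
        (uniqueDiffOn_Icc zero_lt_one y (Ico_subset_Icc_self hy))) x hx
  have hsd : s / θ * d = θ := by
    field_simp
    exact h.symm
  have ha := conserved
    (fun y => f₀ y * Complex.cos (θ * y) - s / θ * f₁ y * Complex.sin (θ * y)) fun y hy => by
      refine (((h₀ y hy).mul (hasDerivAt_cos_mul_ofReal θ y).hasDerivWithinAt).sub
        (((h₁ y hy).const_mul (s / θ)).mul
          (hasDerivAt_sin_mul_ofReal θ y).hasDerivWithinAt)).congr_deriv ?_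
      linear_combination f₀ y * Complex.sin (θ * y) * hsd -
        f₁ y * Complex.cos (θ * y) * (div_mul_cancel₀ s hθ)
  have hb := conserved
    (fun y => f₀ y * Complex.sin (θ * y) + s / θ * f₁ y * Complex.cos (θ * y)) fun y hy => by
      refine (((h₀ y hy).mul (hasDerivAt_sin_mul_ofReal θ y).hasDerivWithinAt).add
        (((h₁ y hy).const_mul (s / θ)).mul
          (hasDerivAt_cos_mul_ofReal θ y).hasDerivWithinAt)).congr_deriv ?_
      linear_combination -f₀ y * Complex.cos (θ * y) * hsd -
        f₁ y * Complex.sin (θ * y) * (div_mul_cancel₀ s hθ)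
  simp only [Complex.ofReal_zero, mul_zero, Complex.cos_zero, Complex.sin_zero, mul_one,
    sub_zero, zero_add] at ha hb
  have hp := Complex.sin_sq_add_cos_sq (θ * x)
  constructor
  · linear_combination Complex.cos (θ * x) * ha + Complex.sin (θ * x) * hb - f₀ x * hp
  · linear_combination Complex.cos (θ * x) * hb - Complex.sin (θ * x) * ha - s / θ * f₁ x * hp

lemma eqOn_diracSol {s d θ : ℂ} (hs : s ≠ 0) (hθ : θ ≠ 0) (hsin : Complex.sin θ ≠ 0)
    (h : θ ^ 2 = s * d) {f₀ f₁ : E → ℝ → ℂ} (e : E)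
    (h₀ : ∀ x ∈ Icc (0 : ℝ) 1, HasDerivWithinAt (f₀ e) (s * f₁ e x) (Icc 0 1) x)
    (h₁ : ∀ x ∈ Icc (0 : ℝ) 1, HasDerivWithinAt (f₁ e) (-d * f₀ e x) (Icc 0 1) x) :
    EqOn (f₀ e) (diracSol₀ θ (utrace (fun _ => 1) f₀) e) (Icc 0 1) ∧
      EqOn (f₁ e) (diracSol₁ s θ (utrace (fun _ => 1) f₀) e) (Icc 0 1) := by
  have key := fun {x} => dirac_system_eqOn hθ h h₀ h₁ (x := x)
  have h1 := (key (x := 1) (by simp)).1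
  simp only [Complex.ofReal_one, mul_one] at h1
  refine ⟨fun x hx => ?_, fun x hx => ?_⟩
  · simp only [diracSol₀, utrace, if_true, Bool.false_eq_true, if_false]
    rw [eq_div_iff hsin, (key hx).1, h1, mul_sub, mul_one, Complex.sin_sub]
    ring
  · simp only [diracSol₁, utrace, if_true, Bool.false_eq_true, if_false]
    have hk := (key hx).2
    have hf : f₁ e x = θ / s * (s / θ * f₁ e x) := by field_simp
    rw [hf, hk]
    congr 1
    rw [eq_div_iff hsin, h1, mul_sub, mul_one, Complex.cos_sub]
    ring

lemma kerCondD_iff {G : Submodule ℂ (Gmax E)} {P : Gmax E →ₗ[ℂ] Gmax E}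
    (hPfix : ∀ F ∈ G, P F = F) (M : G →ₗ[ℂ] G) (m : ℝ) {μ θ : ℂ} (hs : μ + m ≠ 0)
    (hθ : θ ≠ 0) (hsin : Complex.sin θ ≠ 0) (F : G) :
    kerCondD G P M m μ θ F ↔
      P (otrace (fun _ => 1) (diracSol₁ (μ + m) θ (F : Gmax E))) = M F := by
  have hlap : discLap (fun _ => 1) P (F : Gmax E) =
      (F : Gmax E) - P fun h => (F : Gmax E) (hopp h) := by
    conv_rhs =>
      arg 1
      rw [← hPfix F F.2]
    rw [← map_sub (f := P)]
    simp [discLap, Pi.sub_def]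
  have hc : θ / (μ + m) / Complex.sin θ ≠ 0 := div_ne_zero (div_ne_zero hθ hs) hsin
  have hcs : sin1 θ * (μ + m) = (θ / (μ + m) / Complex.sin θ)⁻¹ := by
    simp only [sin1, hθ, if_false]
    field_simp
  rw [kerCondD, hlap, hcs, otrace_diracSol₁, map_smul, map_sub, map_smul, hPfix F F.2,
    ← eq_inv_smul_iff₀ hc, ← sub_eq_zero (b := (_ : ℂ)⁻¹ • _)]
  refine Eq.congr ?_ rfl
  module

lemma isDiracEigenfun_diracSol_iff {G : Submodule ℂ (Gmax E)} {P : Gmax E →ₗ[ℂ] Gmax E}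
    (hPfix : ∀ F ∈ G, P F = F) (M : G →ₗ[ℂ] G) {m : ℝ} {μ θ : ℂ} (hs : μ + m ≠ 0)
    (hθ : θ ≠ 0) (hsin : Complex.sin θ ≠ 0) (h : θ ^ 2 = (μ + m) * (μ - m)) (F : G) :
    IsDiracEigenfun (fun _ => 1) G P M m μ (diracSol₀ θ (F : Gmax E))
      (diracSol₁ (μ + m) θ (F : Gmax E)) ↔ kerCondD G P M m μ θ F := by
  have hF : (⟨utrace (fun _ => 1) (diracSol₀ θ (F : Gmax E)),
      (utrace_diracSol₀ hsin (F : Gmax E)).symm ▸ F.2⟩ : G) = F :=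
    Subtype.ext (utrace_diracSol₀ hsin _)
  rw [kerCondD_iff hPfix M m hs hθ hsin]
  constructor
  · rintro ⟨-, -, -, -, _, hP⟩
    rwa [hF] at hP
  · refine fun hP => ⟨fun e => (contDiff_diracSol₀ θ _ e).contDiffOn,
      fun e => (contDiff_diracSol₁ _ θ _ e).contDiffOn, fun e x hx => ?_, fun e x hx => ?_,
      (utrace_diracSol₀ hsin (F : Gmax E)).symm ▸ F.2, by rw [hF, hP]⟩
    · rw [(hasDerivAt_diracSol₁ hs h _ e x).hasDerivWithinAt.derivWithin
        (uniqueDiffOn_Icc zero_lt_one x hx)]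
      ring
    · rw [(hasDerivAt_diracSol₀ hs _ e x).hasDerivWithinAt.derivWithin
        (uniqueDiffOn_Icc zero_lt_one x hx)]
      ring

lemma IsDiracEigenfun.exists_eqOn_diracSol {G : Submodule ℂ (Gmax E)}
    {P : Gmax E →ₗ[ℂ] Gmax E} (hPfix : ∀ F ∈ G, P F = F) {M : G →ₗ[ℂ] G} {m : ℝ} {μ θ : ℂ}
    (hs : μ + m ≠ 0) (hθ : θ ≠ 0) (hsin : Complex.sin θ ≠ 0)
    (h : θ ^ 2 = (μ + m) * (μ - m)) {f₀ f₁ : E → ℝ → ℂ}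
    (hf : IsDiracEigenfun (fun _ => 1) G P M m μ f₀ f₁) :
    ∃ F : G, kerCondD G P M m μ θ F ∧
      (∀ e, EqOn (f₀ e) (diracSol₀ θ (F : Gmax E) e) (Icc 0 1)) ∧
      (∀ e, EqOn (f₁ e) (diracSol₁ (μ + m) θ (F : Gmax E) e) (Icc 0 1)) := by
  obtain ⟨hc₀, hc₁, hd₁, hd₀, hG, hP⟩ := hf
  have hsol := fun e => eqOn_diracSol (f₀ := f₀) (f₁ := f₁) hs hθ hsin h e
    (fun x hx => by
      refine ((hc₀ e).differentiableOn one_ne_zero x hx).hasDerivWithinAt.congr_deriv ?_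
      linear_combination hd₀ e x hx)
    (fun x hx => by
      refine ((hc₁ e).differentiableOn one_ne_zero x hx).hasDerivWithinAt.congr_deriv ?_
      linear_combination -hd₁ e x hx)
  refine ⟨⟨_, hG⟩, (kerCondD_iff hPfix M m hs hθ hsin _).2 ?_, fun e => (hsol e).1,
    fun e => (hsol e).2⟩
  rw [← hP]
  congr 1
  funext ⟨e, b⟩
  cases b
  · simp [otrace, (hsol e).2 (left_mem_Icc.2 zero_le_one)]
  · simp [otrace, (hsol e).2 (right_mem_Icc.2 zero_le_one)]

lemma eq_of_eqOn_diracSol₀ {θ : ℂ} (hsin : Complex.sin θ ≠ 0) {F F' : Gmax E}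
    (h : ∀ e, EqOn (diracSol₀ θ F e) (diracSol₀ θ F' e) (Icc 0 1)) : F = F' := by
  rw [← utrace_diracSol₀ hsin F, ← utrace_diracSol₀ hsin F']
  funext ⟨e, b⟩
  cases b
  · simpa [utrace] using h e (left_mem_Icc.2 zero_le_one)
  · simpa [utrace] using h e (right_mem_Icc.2 zero_le_one)

lemma sin_ne_zero_of_sq_ne {θ : ℂ} (h : ∀ k : ℕ, θ ^ 2 ≠ ((Real.pi * k : ℝ) : ℂ) ^ 2) :
    Complex.sin θ ≠ 0 := by
  intro h0
  obtain ⟨k, rfl⟩ := Complex.sin_eq_zero_iff.1 h0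
  apply h k.natAbs
  push_cast
  rw [mul_pow, mul_pow, mul_comm]
  congr 1
  rw [Nat.cast_natAbs]
  exact_mod_cast (sq_abs k).symm

/-- On a finite equilateral metric graph, for `μ` with
`μ² - m² = θ²` off the (shifted) Dirichlet spectrum `{(πk)² : k ≥ 0}`, `μ` is an
eigenvalue of the Dirac operator `D_{(G,M)}` iff `0` is an eigenvalue of
`Δ_G - sin₁θ·(μ+m)·M - (1-cos θ)·Id` on `G`; moreover the eigenspaces have equal
dimension (a linear bijection exists). -/
theorem statement3 [Fintype V] [Fintype E] [DecidableEq V]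
    (bd : Bool → E → V)
    (G : Submodule ℂ (Gmax E)) (P : Gmax E →ₗ[ℂ] Gmax E)
    (hPmem : ∀ F, P F ∈ G) (hPfix : ∀ F ∈ G, P F = F)
    (hPsa : ∀ F F' : Gmax E, vinner (P F) F' = vinner F (P F'))
    (hPloc : ∀ (F : Gmax E) (v : V), P (restrAt bd v F) = restrAt bd v (P F))
    (m : ℝ) (M : G →ₗ[ℂ] G)
    (hM : ∀ x y : G,
      vinner (↑(M x) : Gmax E) (↑y : Gmax E) = vinner (↑x : Gmax E) (↑(M y) : Gmax E))
    (μ θ : ℂ) (hμ : ∀ k : ℕ, μ ^ 2 - (m : ℂ) ^ 2 ≠ ((Real.pi * k : ℝ) : ℂ) ^ 2)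
    (hθ : θ ^ 2 = μ ^ 2 - (m : ℂ) ^ 2) :
    -- the spectral relation for eigenvalues
    ((∃ f₀ f₁ : E → ℝ → ℂ,
        IsDiracEigenfun (fun _ => 1) G P M m μ f₀ f₁ ∧
          ∃ e, ∃ x ∈ Icc (0 : ℝ) 1, f₀ e x ≠ 0 ∨ f₁ e x ≠ 0) ↔
      ∃ F : G, F ≠ 0 ∧ kerCondD G P M m μ θ F) ∧
    -- the eigenspaces have equal dimension: a linear bijection
    (∃ Φ₀ Φ₁ : Gmax E → E → ℝ → ℂ,
      (∀ (F F' : Gmax E) (c : ℂ) (e : E) (x : ℝ),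
          Φ₀ (F + c • F') e x = Φ₀ F e x + c * Φ₀ F' e x) ∧
      (∀ (F F' : Gmax E) (c : ℂ) (e : E) (x : ℝ),
          Φ₁ (F + c • F') e x = Φ₁ F e x + c * Φ₁ F' e x) ∧
      (∀ F : G, kerCondD G P M m μ θ F →
          IsDiracEigenfun (fun _ => 1) G P M m μ (Φ₀ ↑F) (Φ₁ ↑F)) ∧
      (∀ F F' : G, kerCondD G P M m μ θ F → kerCondD G P M m μ θ F' →
          (∀ e, EqOn (Φ₀ (↑F : Gmax E) e) (Φ₀ (↑F' : Gmax E) e) (Icc 0 1)) →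
          (∀ e, EqOn (Φ₁ (↑F : Gmax E) e) (Φ₁ (↑F' : Gmax E) e) (Icc 0 1)) → F = F') ∧
      (∀ f₀ f₁ : E → ℝ → ℂ, IsDiracEigenfun (fun _ => 1) G P M m μ f₀ f₁ →
          ∃ F : G, kerCondD G P M m μ θ F ∧
            (∀ e, EqOn (f₀ e) (Φ₀ (↑F : Gmax E) e) (Icc 0 1)) ∧
            (∀ e, EqOn (f₁ e) (Φ₁ (↑F : Gmax E) e) (Icc 0 1)))) := by
  have hsin : Complex.sin θ ≠ 0 := sin_ne_zero_of_sq_ne (by rwa [hθ])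
  have hθ0 : θ ≠ 0 := by
    rintro rfl
    simp at hsin
  have h : θ ^ 2 = (μ + m) * (μ - m) := by
    rw [hθ]
    ring
  have hs : μ + m ≠ 0 := by
    intro h0
    rw [h0, zero_mul] at h
    exact hθ0 (pow_eq_zero_iff two_ne_zero |>.1 h)
  refine ⟨⟨?_, ?_⟩, diracSol₀ θ, diracSol₁ (μ + m) θ, fun F F' c e x => ?_,
    fun F F' c e x => ?_, fun F => (isDiracEigenfun_diracSol_iff hPfix M hs hθ0 hsin h F).2,
    fun F F' _ _ h₀ _ => Subtype.ext (eq_of_eqOn_diracSol₀ hsin h₀),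
    fun f₀ f₁ hf => hf.exists_eqOn_diracSol hPfix hs hθ0 hsin h⟩
  · rintro ⟨f₀, f₁, hf, e, x, hx, hne⟩
    obtain ⟨F, hF, h₀, h₁⟩ := hf.exists_eqOn_diracSol hPfix hs hθ0 hsin h
    refine ⟨F, ?_, hF⟩
    rintro rfl
    rw [h₀ e hx, h₁ e hx] at hne
    simp [diracSol₀, diracSol₁] at hne
  · rintro ⟨F, hF, hk⟩
    refine ⟨_, _, (isDiracEigenfun_diracSol_iff hPfix M hs hθ0 hsin h F).2 hk, ?_⟩
    by_contra! hzero
    refine hF (Subtype.ext (eq_of_eqOn_diracSol₀ hsin fun e x hx => ?_))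
    rw [(hzero e x hx).1]
    simp [diracSol₀]
  · simp only [diracSol₀, Pi.add_apply, Pi.smul_apply, smul_eq_mul]
    ring
  · simp only [diracSol₁, Pi.add_apply, Pi.smul_apply, smul_eq_mul]
    ring
end
end

section
/- Let X be a finite metric graph with edge lengths 0 < ℓ₀ ≤ ℓ_e ≤ 1, G ⊆ G^max a vertex space, m ∈ ℝ, and w ∈ ℂ with w ≠ ±m; set z := w² − m². Then the map f ↦ ( f , f'/(w+m) ) is a linear bijection from the space N_Δ^z := { f : each f_e twice continuously differentiable on [0,ℓ_e], −f_e'' = z f_e on every edge, and f̲ ∈ G } onto the space N_D^w := { (f₀, f₁) : each f_{p,e} continuously differentiable on [0,ℓ_e], m f₀ − f₁' = w f₀ and f₀' − m f₁ = w f₁ on every edge, and f̲₀ ∈ G }. -/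
noncomputable section

open Complex Set MeasureTheory

variable {V E : Type*}

/-- `f` belongs to `N_Δ^z`: edgewise `C²`, `-f'' = z f` on every edge,
and `f̲ ∈ G`. -/
def InNLap {E : Type*} (ℓ : E → ℝ) (G : Submodule ℂ (Gmax E)) (z : ℂ)
    (f : E → ℝ → ℂ) : Prop :=
  (∀ e, ContDiffOn ℝ 2 (f e) (Icc 0 (ℓ e))) ∧
  (∀ e, ∀ x ∈ Icc (0 : ℝ) (ℓ e),
      iteratedDerivWithin 2 (f e) (Icc 0 (ℓ e)) x = -(z * f e x)) ∧
  utrace ℓ f ∈ G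

/-- `(f₀, f₁)` belongs to `N_D^w`: edgewise `C¹`, Dirac system
`m f₀ - f₁' = w f₀`, `f₀' - m f₁ = w f₁` on every edge, and `f̲₀ ∈ G`. -/
def InNDir {E : Type*} (ℓ : E → ℝ) (G : Submodule ℂ (Gmax E)) (m : ℝ) (w : ℂ)
    (f₀ f₁ : E → ℝ → ℂ) : Prop :=
  (∀ e, ContDiffOn ℝ 1 (f₀ e) (Icc 0 (ℓ e))) ∧
  (∀ e, ContDiffOn ℝ 1 (f₁ e) (Icc 0 (ℓ e))) ∧
  (∀ e, ∀ x ∈ Icc (0 : ℝ) (ℓ e),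
      (m : ℂ) * f₀ e x - derivWithin (f₁ e) (Icc 0 (ℓ e)) x = w * f₀ e x) ∧
  (∀ e, ∀ x ∈ Icc (0 : ℝ) (ℓ e),
      derivWithin (f₀ e) (Icc 0 (ℓ e)) x - (m : ℂ) * f₁ e x = w * f₁ e x) ∧
  utrace ℓ f₀ ∈ G

theorem contDiffOn_two_iff_derivWithin {F : Type*} [NormedAddCommGroup F] [NormedSpace ℝ F]
    {f : ℝ → F} {s : Set ℝ} (hs : UniqueDiffOn ℝ s) :
    ContDiffOn ℝ 2 f s ↔ DifferentiableOn ℝ f s ∧ ContDiffOn ℝ 1 (derivWithin f s) s := by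
  rw [show (2 : WithTop ℕ∞) = 1 + 1 by norm_num, contDiffOn_succ_iff_derivWithin hs]
  simp

theorem iteratedDerivWithin_two_eq {F : Type*} [NormedAddCommGroup F] [NormedSpace ℝ F]
    {f : ℝ → F} {s : Set ℝ} {x : ℝ} :
    iteratedDerivWithin 2 f s x = derivWithin (derivWithin f s) s x := by
  rw [show 2 = 1 + 1 from rfl, iteratedDerivWithin_succ]
  exact derivWithin_congr (fun y _ => congrFun iteratedDerivWithin_one y)
    (congrFun iteratedDerivWithin_one x)

theorem derivWithin_add_const_mul {f g : ℝ → ℂ} {s : Set ℝ} {x : ℝ} (c : ℂ)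
    (hf : DifferentiableWithinAt ℝ f s x) (hg : DifferentiableWithinAt ℝ g s x) :
    derivWithin (fun y => f y + c * g y) s x = derivWithin f s x + c * derivWithin g s x := by
  rw [derivWithin_fun_add hf (hg.const_mul c), derivWithin_const_mul c hg]

theorem utrace_add_const_mul (ℓ : E → ℝ) (f g : E → ℝ → ℂ) (c : ℂ) :
    utrace ℓ (fun e x => f e x + c * g e x) = utrace ℓ f + c • utrace ℓ g := by
  funext h
  by_cases hh : h.2 <;> simp [utrace, hh]

theorem InNLap.add_const_mul {ℓ : E → ℝ} (hℓ : ∀ e, 0 < ℓ e) {G : Submodule ℂ (Gmax E)} {z : ℂ}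
    {f g : E → ℝ → ℂ} (hf : InNLap ℓ G z f) (hg : InNLap ℓ G z g) (c : ℂ) :
    InNLap ℓ G z (fun e x => f e x + c * g e x) := by
  obtain ⟨hf2, hfe, hfG⟩ := hf
  obtain ⟨hg2, hge, hgG⟩ := hg
  refine ⟨fun e => (hf2 e).add (contDiffOn_const.mul (hg2 e)), fun e x hx => ?_, ?_⟩
  · have hs := uniqueDiffOn_Icc (hℓ e)
    obtain ⟨df, df'⟩ := (contDiffOn_two_iff_derivWithin hs).1 (hf2 e)
    obtain ⟨dg, dg'⟩ := (contDiffOn_two_iff_derivWithin hs).1 (hg2 e)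
    have hD : EqOn (derivWithin (fun y => f e y + c * g e y) (Icc 0 (ℓ e)))
        (fun y => derivWithin (f e) (Icc 0 (ℓ e)) y + c * derivWithin (g e) (Icc 0 (ℓ e)) y)
        (Icc 0 (ℓ e)) := fun y hy => derivWithin_add_const_mul c (df y hy) (dg y hy)
    have hf'' := hfe e x hx
    have hg'' := hge e x hx
    rw [iteratedDerivWithin_two_eq] at hf'' hg'' ⊢
    rw [derivWithin_congr hD (hD hx), derivWithin_add_const_mul c
      (df'.differentiableOn one_ne_zero x hx) (dg'.differentiableOn one_ne_zero x hx), hf'', hg'']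
    ring
  · rw [utrace_add_const_mul]
    exact G.add_mem hfG (G.smul_mem c hgG)

theorem InNLap.inNDir {ℓ : E → ℝ} (hℓ : ∀ e, 0 < ℓ e) {G : Submodule ℂ (Gmax E)} {m : ℝ} {w : ℂ}
    (hw : w + (m : ℂ) ≠ 0) {f : E → ℝ → ℂ} (hf : InNLap ℓ G (w ^ 2 - (m : ℂ) ^ 2) f) :
    InNDir ℓ G m w f (fun e x => derivWithin (f e) (Icc 0 (ℓ e)) x / (w + (m : ℂ))) := by
  obtain ⟨hf2, hfe, hfG⟩ := hf
  refine ⟨fun e => (hf2 e).of_le one_le_two, fun e => ?_, fun e x hx => ?_, fun e x hx => ?_, hfG⟩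
  · exact ((contDiffOn_two_iff_derivWithin (uniqueDiffOn_Icc (hℓ e))).1 (hf2 e)).2.div_const _
  · have hf'' := hfe e x hx
    rw [iteratedDerivWithin_two_eq] at hf''
    rw [derivWithin_div_const, hf'']
    field_simp
    ring
  · field_simp
    ring

theorem InNDir.inNLap {ℓ : E → ℝ} (hℓ : ∀ e, 0 < ℓ e) {G : Submodule ℂ (Gmax E)} {m : ℝ} {w : ℂ}
    {f₀ f₁ : E → ℝ → ℂ} (hf : InNDir ℓ G m w f₀ f₁) :
    InNLap ℓ G (w ^ 2 - (m : ℂ) ^ 2) f₀ := by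
  obtain ⟨h0, h1, e1, e0, hG⟩ := hf
  have hD (e) : EqOn (derivWithin (f₀ e) (Icc 0 (ℓ e))) (fun x => (w + (m : ℂ)) * f₁ e x)
      (Icc 0 (ℓ e)) := fun x hx => by linear_combination e0 e x hx
  refine ⟨fun e => ?_, fun e x hx => ?_, hG⟩
  · exact (contDiffOn_two_iff_derivWithin (uniqueDiffOn_Icc (hℓ e))).2
      ⟨(h0 e).differentiableOn one_ne_zero, (contDiffOn_const.mul (h1 e)).congr (hD e)⟩
  · rw [iteratedDerivWithin_two_eq, derivWithin_congr (hD e) (hD e hx),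
      derivWithin_const_mul _ ((h1 e).differentiableOn one_ne_zero x hx)]
    linear_combination -(w + (m : ℂ)) * e1 e x hx

/-- For `w ≠ ±m` and `z = w² - m²`, the map `f ↦ (f, f'/(w+m))`
is a linear bijection from `N_Δ^z` onto `N_D^w`. -/
theorem statement10 [Fintype V] [Fintype E]
    (bd : Bool → E → V)
    (ℓ : E → ℝ) (ℓ₀ : ℝ) (hℓ₀ : 0 < ℓ₀) (hℓ : ∀ e, ℓ₀ ≤ ℓ e ∧ ℓ e ≤ 1)
    (G : Submodule ℂ (Gmax E))
    (m : ℝ) (w : ℂ) (hw : w ≠ (m : ℂ) ∧ w ≠ -(m : ℂ)) :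
    -- the map sends `N_Δ^{w² - m²}` into `N_D^w`
    (∀ f : E → ℝ → ℂ, InNLap ℓ G (w ^ 2 - (m : ℂ) ^ 2) f →
        InNDir ℓ G m w f
          (fun e x => derivWithin (f e) (Icc 0 (ℓ e)) x / (w + (m : ℂ)))) ∧
    -- the map is linear (on `N_Δ^z`, up to values on the edge intervals)
    (∀ f g : E → ℝ → ℂ, InNLap ℓ G (w ^ 2 - (m : ℂ) ^ 2) f →
        InNLap ℓ G (w ^ 2 - (m : ℂ) ^ 2) g → ∀ c : ℂ,
        InNLap ℓ G (w ^ 2 - (m : ℂ) ^ 2) (fun e x => f e x + c * g e x) ∧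
        ∀ e, EqOn
          (fun x => derivWithin (fun y => f e y + c * g e y) (Icc 0 (ℓ e)) x / (w + (m : ℂ)))
          (fun x => derivWithin (f e) (Icc 0 (ℓ e)) x / (w + (m : ℂ))
            + c * (derivWithin (g e) (Icc 0 (ℓ e)) x / (w + (m : ℂ))))
          (Icc 0 (ℓ e))) ∧
    -- the map is injective (determined on the edge intervals)
    (∀ f g : E → ℝ → ℂ, InNLap ℓ G (w ^ 2 - (m : ℂ) ^ 2) f →
        InNLap ℓ G (w ^ 2 - (m : ℂ) ^ 2) g →
        (∀ e, EqOn (f e) (g e) (Icc 0 (ℓ e))) →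
        (∀ e, EqOn
          (fun x => derivWithin (f e) (Icc 0 (ℓ e)) x / (w + (m : ℂ)))
          (fun x => derivWithin (g e) (Icc 0 (ℓ e)) x / (w + (m : ℂ)))
          (Icc 0 (ℓ e)))) ∧
    -- the map is surjective onto `N_D^w`, with uniqueness of the preimage
    (∀ f₀ f₁ : E → ℝ → ℂ, InNDir ℓ G m w f₀ f₁ →
        ∃ f : E → ℝ → ℂ, InNLap ℓ G (w ^ 2 - (m : ℂ) ^ 2) f ∧
          (∀ e, EqOn (f₀ e) (f e) (Icc 0 (ℓ e))) ∧
          (∀ e, EqOn (f₁ e)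
            (fun x => derivWithin (f e) (Icc 0 (ℓ e)) x / (w + (m : ℂ)))
            (Icc 0 (ℓ e))) ∧
          ∀ g : E → ℝ → ℂ, InNLap ℓ G (w ^ 2 - (m : ℂ) ^ 2) g →
            (∀ e, EqOn (f₀ e) (g e) (Icc 0 (ℓ e))) →
            ∀ e, EqOn (f e) (g e) (Icc 0 (ℓ e))) := by
  have hpos (e) : 0 < ℓ e := hℓ₀.trans_le (hℓ e).1
  have hwm : w + (m : ℂ) ≠ 0 := fun h => hw.2 (eq_neg_of_add_eq_zero_left h)
  refine ⟨fun f hf => hf.inNDir hpos hwm, fun f g hf hg c =>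
    ⟨hf.add_const_mul hpos hg c, fun e x hx => ?_⟩, fun f g _ _ hfg e x hx => ?_,
    fun f₀ f₁ h => ⟨f₀, h.inNLap hpos, fun e x _ => rfl, fun e x hx => ?_,
      fun g _ hfg => hfg⟩⟩
  · simp only
    rw [derivWithin_add_const_mul c ((hf.1 e).differentiableOn two_ne_zero x hx)
      ((hg.1 e).differentiableOn two_ne_zero x hx)]
    ring
  · simp only
    rw [derivWithin_congr (hfg e) (hfg e hx)]
  · rw [eq_div_iff hwm]
    linear_combination -h.2.2.2.1 e x hx
end
end

section
/- Let X be a finite metric graph with edge lengths ℓ_e > 0, let G ⊆ G^max be a vertex space with orthogonal projection P, and let f = (f_e), g = (g_e) be families of continuously differentiable functions on the edges such that the unoriented vertex evaluation satisfies f̲ ∈ G. Then Σ_{e∈E} ∫₀^{ℓ_e} conj(f_e'(x))·g_e(x) dx = − Σ_{e∈E} ∫₀^{ℓ_e} conj(f_e(x))·g_e'(x) dx + ⟨ f̲ , P(g̲°) ⟩_G, i.e. the boundary term can be computed with the projected oriented evaluation of g. -/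
noncomputable section

open Complex Set MeasureTheory

variable {V E : Type*}

/-- Integration by parts on `[a, b]` for a sesquilinear product of `C¹` functions. -/
theorem integral_conj_derivWithin_mul {a b : ℝ} (hab : a < b) {u v : ℝ → ℂ}
    (hu : ContDiffOn ℝ 1 u (Icc a b)) (hv : ContDiffOn ℝ 1 v (Icc a b)) :
    ∫ x in a..b, (starRingEnd ℂ) (derivWithin u (Icc a b) x) * v x
      = -(∫ x in a..b, (starRingEnd ℂ) (u x) * derivWithin v (Icc a b) x)
        + ((starRingEnd ℂ) (u b) * v b - (starRingEnd ℂ) (u a) * v a) := by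
  have hI : uIcc a b = Icc a b := uIcc_of_le hab.le
  have hs : UniqueDiffOn ℝ (Icc a b) := uniqueDiffOn_Icc hab
  have hu' := hu.continuousOn_derivWithin hs le_rfl
  have hv' := hv.continuousOn_derivWithin hs le_rfl
  have key := intervalIntegral.integral_deriv_mul_eq_sub_of_hasDerivWithinAt
    (a := a) (b := b) (u := fun x => (starRingEnd ℂ) (u x)) (v := v)
    (u' := fun x => (starRingEnd ℂ) (derivWithin u (Icc a b) x))
    (v' := derivWithin v (Icc a b))
    (fun x hx => by
      rw [hI] at hx ⊢
      exact ((hu.differentiableOn one_ne_zero) x hx).hasDerivWithinAt.star)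
    (fun x hx => by
      rw [hI] at hx ⊢
      exact ((hv.differentiableOn one_ne_zero) x hx).hasDerivWithinAt)
    (by
      refine ContinuousOn.intervalIntegrable ?_
      rw [hI]
      exact continuous_conj.comp_continuousOn hu')
    (by
      refine ContinuousOn.intervalIntegrable ?_
      rwa [hI])
  rw [intervalIntegral.integral_add] at key
  · linear_combination key
  · refine ContinuousOn.intervalIntegrable ?_
    rw [hI]
    exact (continuous_conj.comp_continuousOn hu').mul hv.continuousOn
  · refine ContinuousOn.intervalIntegrable ?_
    rw [hI]
    exact (continuous_conj.comp_continuousOn hu.continuousOn).mul hv'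

/-- Integration by parts with projected boundary term: if the
unoriented vertex evaluation of `f` lies in the vertex space `G` with orthogonal
projection `P`, then
`∑_e ∫₀^{ℓ_e} conj(f') g = -∑_e ∫₀^{ℓ_e} conj(f) g' + ⟨f̲, P g̲°⟩`. -/
theorem statement17 [Fintype V] [Fintype E] [DecidableEq V]
    (bd : Bool → E → V) (ℓ : E → ℝ) (hℓ : ∀ e, 0 < ℓ e)
    (G : Submodule ℂ (Gmax E)) (P : Gmax E →ₗ[ℂ] Gmax E)
    (hPmem : ∀ F, P F ∈ G) (hPfix : ∀ F ∈ G, P F = F)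
    (hPsa : ∀ F F' : Gmax E, vinner (P F) F' = vinner F (P F'))
    (hPloc : ∀ (F : Gmax E) (v : V), P (restrAt bd v F) = restrAt bd v (P F))
    (f g : E → ℝ → ℂ)
    (hf : ∀ e, ContDiffOn ℝ 1 (f e) (Icc 0 (ℓ e)))
    (hg : ∀ e, ContDiffOn ℝ 1 (g e) (Icc 0 (ℓ e)))
    (hfG : utrace ℓ f ∈ G) :
    ∑ e : E, ∫ x in (0 : ℝ)..(ℓ e),
        (starRingEnd ℂ) (derivWithin (f e) (Icc 0 (ℓ e)) x) * g e x
      = -(∑ e : E, ∫ x in (0 : ℝ)..(ℓ e),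
            (starRingEnd ℂ) (f e x) * derivWithin (g e) (Icc 0 (ℓ e)) x)
        + vinner (utrace ℓ f) (P (otrace ℓ g)) := by
  rw [← hPsa, hPfix _ hfG, Finset.sum_congr rfl fun e _ =>
    integral_conj_derivWithin_mul (hℓ e) (hf e) (hg e), Finset.sum_add_distrib,
    Finset.sum_neg_distrib]
  congr 1
  simp [vinner, utrace, otrace, Fintype.sum_prod_type, sub_eq_add_neg]
end
end
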